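/- Let P be an augmented program and M ⊆ σ_P a set of atoms. Then M is a min-answer set of P (both an answer set of P and a minimal model of P) if and only if P ∪ ¬M̃ is consistent in intuitionistic logic and P ∪ ¬M̃ ⊢_I a for every a ∈ M. -/

import Mathlib

namespace ASP

/-- Propositional formulas over atoms `α`, built with ∧, ∨, ← and ⊥.
`impl A B` denotes the formula `B ← A` (i.e. `A → B`). -/
inductive PropForm (α : Type) : Type
  | var : α → PropForm α
  | fals : PropForm α
  | conj : PropForm α → PropForm α → PropForm α
  | disj : PropForm α → PropForm α → PropForm α
  | impl : PropForm α → PropForm α → PropForm α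
  deriving DecidableEq

namespace PropForm

variable {α : Type}

/-- `¬F` abbreviates `⊥ ← F`. -/
def neg (A : PropForm α) : PropForm α := impl A fals

/-- `⊤` abbreviates `⊥ ← ⊥`. -/
def top : PropForm α := impl fals fals

/-- The set of atoms occurring in a formula. -/
def atoms : PropForm α → Set α
  | var a => {a}
  | fals => ∅
  | conj A B => atoms A ∪ atoms B
  | disj A B => atoms A ∪ atoms B
  | impl A B => atoms A ∪ atoms B

end PropForm

open PropForm

/-- Hilbert-style derivability for intuitionistic propositional logic,
with an extra set `Ax` of additional axioms. -/
inductive Deriv {α : Type} (Ax : Set (PropForm α)) : PropForm α → Prop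
  | ax {A} : A ∈ Ax → Deriv Ax A
  | k (A B) : Deriv Ax (impl A (impl B A))
  | s (A B C) : Deriv Ax (impl (impl A (impl B C)) (impl (impl A B) (impl A C)))
  | conjIntro (A B) : Deriv Ax (impl A (impl B (conj A B)))
  | conjElimL (A B) : Deriv Ax (impl (conj A B) A)
  | conjElimR (A B) : Deriv Ax (impl (conj A B) B)
  | disjIntroL (A B) : Deriv Ax (impl A (disj A B))
  | disjIntroR (A B) : Deriv Ax (impl B (disj A B))
  | disjElim (A B C) : Deriv Ax (impl (impl A C) (impl (impl B C) (impl (disj A B) C)))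
  | falsElim (A) : Deriv Ax (impl fals A)
  | mp {A B} : Deriv Ax (impl A B) → Deriv Ax A → Deriv Ax B

/-- `F` is a theorem of intuitionistic propositional logic. -/
def IThm {α : Type} (F : PropForm α) : Prop := Deriv ∅ F

/-- `F` is a theorem of classical propositional logic
(intuitionistic logic plus double-negation elimination). -/
def CThm {α : Type} (F : PropForm α) : Prop :=
  Deriv {F | ∃ A, F = impl (neg (neg A)) A} F

/-- Conjunction of a finite list of formulas (empty conjunction is ⊤). -/
def bigConj {α : Type} : List (PropForm α) → PropForm α
  | [] => top
  | [A] => A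
  | A :: L => conj A (bigConj L)

/-- Disjunction of a finite list of formulas (empty disjunction is ⊥). -/
def bigDisj {α : Type} : List (PropForm α) → PropForm α
  | [] => fals
  | [A] => A
  | A :: L => disj A (bigDisj L)

/-- `T ⊢_X F`: the formula `F ← (F₁ ∧ ... ∧ Fₙ)` is a theorem of the logic
whose theorems are `Thm`, for some `F₁, ..., Fₙ ∈ T`. -/
def ProvesFrom {α : Type} (Thm : PropForm α → Prop) (T : Set (PropForm α))
    (F : PropForm α) : Prop :=
  ∃ L : List (PropForm α), (∀ G ∈ L, G ∈ T) ∧ Thm (impl (bigConj L) F)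

/-- `T ⊢_I F`. -/
def IProves {α : Type} (T : Set (PropForm α)) (F : PropForm α) : Prop :=
  ProvesFrom IThm T F

/-- `T ⊢_C F`. -/
def CProves {α : Type} (T : Set (PropForm α)) (F : PropForm α) : Prop :=
  ProvesFrom CThm T F

/-- `T` is consistent in intuitionistic logic. -/
def IConsistent {α : Type} (T : Set (PropForm α)) : Prop := ¬ IProves T fals

/-- `T ⊩_I M`: `T` is consistent and proves (intuitionistically) every atom of `M`. -/
def IProvesAll {α : Type} (T : Set (PropForm α)) (M : Set α) : Prop :=
  IConsistent T ∧ ∀ a ∈ M, IProves T (var a)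

/-- `T ≡_I U`: the two theories prove each other's formulas intuitionistically. -/
def IEquivTh {α : Type} (T U : Set (PropForm α)) : Prop :=
  (∀ F ∈ U, IProves T F) ∧ (∀ F ∈ T, IProves U F)

/-- The signature (set of occurring atoms) of a theory. -/
def sigTh {α : Type} (T : Set (PropForm α)) : Set α := ⋃ F ∈ T, F.atoms

/-- `T` is (literal) complete: for every atom `a` of its signature,
`T ⊢_I a` or `T ⊢_I ¬a`. -/
def IComplete {α : Type} (T : Set (PropForm α)) : Prop :=
  ∀ a ∈ sigTh T, IProves T (var a) ∨ IProves T (neg (var a))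

/-- `{¬a : a ∈ S}`. -/
def negSet {α : Type} (S : Set α) : Set (PropForm α) := (fun a => neg (var a)) '' S

/-- `{¬¬a : a ∈ S}`. -/
def negnegSet {α : Type} (S : Set α) : Set (PropForm α) :=
  (fun a => neg (neg (var a))) '' S

/-- Classical two-valued satisfaction, identifying an interpretation with the
set of atoms it makes true. -/
def sat2 {α : Type} (X : Set α) : PropForm α → Prop
  | .var a => a ∈ X
  | .fals => False
  | .conj A B => sat2 X A ∧ sat2 X B
  | .disj A B => sat2 X A ∨ sat2 X B
  | .impl A B => sat2 X A → sat2 X B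

/-- `X` is a classical model of the theory `T`. -/
def isModel2 {α : Type} (X : Set α) (T : Set (PropForm α)) : Prop := ∀ F ∈ T, sat2 X F

/-- `M` is a minimal (under ⊆) classical model of `T`. -/
def isMinModel {α : Type} (T : Set (PropForm α)) (M : Set α) : Prop :=
  isModel2 M T ∧ ∀ N ⊆ M, isModel2 N T → N = M

/-- Evaluation in the 3-valued Gödel logic G3. -/
def g3 {α : Type} (I : α → Fin 3) : PropForm α → Fin 3
  | .var a => I a
  | .fals => 0
  | .conj A B => min (g3 I A) (g3 I B)
  | .disj A B => max (g3 I A) (g3 I B)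
  | .impl A B => if g3 I A ≤ g3 I B then 2 else g3 I B

/-- Nested formulas: built from atoms, ⊤ and ⊥ using ∧, ∨ and ¬. -/
inductive NF (α : Type) : Type
  | var : α → NF α
  | top : NF α
  | bot : NF α
  | conj : NF α → NF α → NF α
  | disj : NF α → NF α → NF α
  | neg : NF α → NF α
  deriving DecidableEq

namespace NF

variable {α : Type}

/-- Reading a nested formula as a propositional formula
(`⊤ = ⊥ ← ⊥` and `¬F = ⊥ ← F`). -/
def toProp : NF α → PropForm α
  | var a => .var a
  | top => PropForm.top
  | bot => .fals
  | conj A B => .conj (toProp A) (toProp B)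
  | disj A B => .disj (toProp A) (toProp B)
  | neg A => PropForm.neg (toProp A)

/-- Atoms occurring in a nested formula. -/
def atoms : NF α → Set α
  | var a => {a}
  | top => ∅
  | bot => ∅
  | conj A B => atoms A ∪ atoms B
  | disj A B => atoms A ∪ atoms B
  | neg A => atoms A

/-- Satisfaction of a (basic, negation-free) nested formula by a set of atoms. -/
def satB (X : Set α) : NF α → Prop
  | var a => a ∈ X
  | top => True
  | bot => False
  | conj A B => satB X A ∧ satB X B
  | disj A B => satB X A ∨ satB X B
  | neg A => ¬ satB X A

open scoped Classical in
/-- The reduct `F^X`: each maximal subformula `¬G` is replaced by ⊥ if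
`X ⊨ G^X` and by ⊤ otherwise. -/
noncomputable def reduct (X : Set α) : NF α → NF α
  | var a => var a
  | top => top
  | bot => bot
  | conj A B => conj (reduct X A) (reduct X B)
  | disj A B => disj (reduct X A) (reduct X B)
  | neg A => if satB X (reduct X A) then bot else top

end NF

/-- An augmented clause `H ← B` is a pair `(H, B)` of nested formulas. -/
abbrev AugClause (α : Type) := NF α × NF α

/-- The propositional formula `H ← B` of an augmented clause. -/
def clauseToProp {α : Type} (c : AugClause α) : PropForm α :=
  .impl c.2.toProp c.1.toProp

/-- The theory of an augmented program. -/
def progTh {α : Type} (P : List (AugClause α)) : Set (PropForm α) :=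
  {F | ∃ c ∈ P, clauseToProp c = F}

/-- The signature of an augmented program. -/
def progSig {α : Type} (P : List (AugClause α)) : Set α :=
  {a | ∃ c ∈ P, a ∈ c.1.atoms ∪ c.2.atoms}

/-- `X` is closed under the (basic) program `P`: for each clause `H ← B`,
`X ⊨ H` whenever `X ⊨ B`. -/
def closedUnder {α : Type} (X : Set α) (P : List (AugClause α)) : Prop :=
  ∀ c ∈ P, NF.satB X c.2 → NF.satB X c.1

/-- The reduct `P^X` of an augmented program. -/
noncomputable def progReduct {α : Type} (X : Set α) (P : List (AugClause α)) :
    List (AugClause α) :=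
  P.map fun c => (c.1.reduct X, c.2.reduct X)

/-- `M` is an answer set of `P`: `M` is minimal (under ⊆) among the sets of
atoms closed under the reduct `P^M`. -/
def isAnswerSet {α : Type} (P : List (AugClause α)) (M : Set α) : Prop :=
  closedUnder M (progReduct M P) ∧ ∀ N ⊆ M, closedUnder N (progReduct M P) → N = M

/-- `M` is a min-answer set of `P`: both an answer set and a minimal model. -/
def isMinAnswerSet {α : Type} (P : List (AugClause α)) (M : Set α) : Prop :=
  isAnswerSet P M ∧ isMinModel (progTh P) M

/-- A G3 interpretation models an augmented program. -/
def g3ModelsProg {α : Type} (I : α → Fin 3) (P : List (AugClause α)) : Prop :=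
  ∀ c ∈ P, g3 I (clauseToProp c) = 2

/-- A free clause: a list of head literals and a list of body literals,
a literal being an atom `(a, true)` or a negated atom `(a, false)`.
It denotes `h₁ ∨ ... ∨ hₙ ← b₁ ∧ ... ∧ bₘ` (empty head = ⊥, empty body = ⊤). -/
structure FClause (α : Type) where
  head : List (α × Bool)
  body : List (α × Bool)
  deriving DecidableEq

/-- The propositional formula of a literal. -/
def litToProp {α : Type} : α × Bool → PropForm α
  | (a, true) => .var a
  | (a, false) => PropForm.neg (.var a)

/-- The nested formula of a literal. -/
def litToNF {α : Type} : α × Bool → NF α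
  | (a, true) => .var a
  | (a, false) => .neg (.var a)

/-- Disjunction of a list of nested formulas (empty = ⊥). -/
def bigDisjNF {α : Type} : List (NF α) → NF α
  | [] => .bot
  | [A] => A
  | A :: L => .disj A (bigDisjNF L)

/-- Conjunction of a list of nested formulas (empty = ⊤). -/
def bigConjNF {α : Type} : List (NF α) → NF α
  | [] => .top
  | [A] => A
  | A :: L => .conj A (bigConjNF L)

namespace FClause

variable {α : Type}

/-- The propositional formula of a free clause. -/
def toProp (c : FClause α) : PropForm α :=
  .impl (bigConj (c.body.map litToProp)) (bigDisj (c.head.map litToProp))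

/-- A free clause as an augmented clause. -/
def toAug (c : FClause α) : AugClause α :=
  (bigDisjNF (c.head.map litToNF), bigConjNF (c.body.map litToNF))

/-- The atoms of a free clause. -/
def atomsF (c : FClause α) : Set α :=
  {a | (∃ b, (a, b) ∈ c.head) ∨ (∃ b, (a, b) ∈ c.body)}

/-- A general clause: all head literals are positive atoms. -/
def isGeneral (c : FClause α) : Prop := ∀ l ∈ c.head, l.2 = true

/-- A disjunctive clause: a general clause with nonempty head. -/
def isDisjunctive (c : FClause α) : Prop := c.isGeneral ∧ c.head ≠ []

/-- A constraint: a clause with empty head (head ⊥). -/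
def isConstraint (c : FClause α) : Prop := c.head = []

end FClause

/-- The theory of a free program. -/
def fTh {α : Type} (P : List (FClause α)) : Set (PropForm α) :=
  {F | ∃ c ∈ P, c.toProp = F}

/-- The signature of a free program. -/
def fSig {α : Type} (P : List (FClause α)) : Set α :=
  {a | ∃ c ∈ P, a ∈ c.atomsF}

/-- `GenDisj(P)`: each constraint `⊥ ← B` is replaced by `p ← B ∧ ¬p`,
where `p` is a new reserved atom. -/
def genDisj {α : Type} [DecidableEq α] (P : List (FClause α)) (p : α) :
    List (FClause α) :=
  P.map fun c =>
    if c.head = [] then ⟨[(p, true)], c.body ++ [(p, false)]⟩ else c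

/-- The atoms `a` such that `¬a` occurs in the head of some clause of `P`
(the set `S` of the FreeGen transformation), as a list. -/
def headNegs {α : Type} (P : List (FClause α)) : List α :=
  P.flatMap fun c => c.head.filterMap fun l => if l.2 = false then some l.1 else none

open scoped Classical in
/-- Replace the occurrence of `¬a` (for `a ∈ S`) by the positive atom `φ a`. -/
noncomputable def substLit {α : Type} (S : Set α) (φ : α → α) (l : α × Bool) :
    α × Bool :=
  if l.2 = false ∧ l.1 ∈ S then (φ l.1, true) else l

/-- Replace every occurrence of `¬a` (for `a ∈ S`) by `φ a` in a clause. -/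
noncomputable def FClause.subst {α : Type} (S : Set α) (φ : α → α) (c : FClause α) :
    FClause α :=
  ⟨c.head.map (substLit S φ), c.body.map (substLit S φ)⟩

/-- `Δ_S = ⋃_{a ∈ S} {φ(a) ← ¬a, ⊥ ← a ∧ φ(a)}`. -/
def deltaClauses {α : Type} (L : List α) (φ : α → α) : List (FClause α) :=
  L.flatMap fun a => [⟨[(φ a, true)], [(a, false)]⟩, ⟨[], [(a, true), (φ a, true)]⟩]

/-- `FreeGen(P) = P' ∪ Δ_S`. -/
noncomputable def freeGen {α : Type} (P : List (FClause α)) (φ : α → α) :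
    List (FClause α) :=
  P.map (FClause.subst {a | a ∈ headNegs P} φ) ++ deltaClauses (headNegs P) φ

open scoped Classical in
/-- The second reduction `redu2(P; ¬¬M)`: clauses whose body contains a literal
`¬a` with `a ∈ M` are deleted; in constraints, positive body literals `a ∈ M`
are deleted. -/
noncomputable def redu2 {α : Type} [DecidableEq α] (P : List (FClause α))
    (M : Set α) : List (FClause α) :=
  (P.filter fun c => decide (¬ ∃ l ∈ c.body, l.2 = false ∧ l.1 ∈ M)).map
    fun c =>
      if c.head = [] then
        ⟨[], c.body.filter fun l => decide (¬ (l.2 = true ∧ l.1 ∈ M))⟩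
      else c

/-- `P₂` is a conservative extension of `P₁`: `M₁` is an answer set of `P₁`
iff `M₂` is an answer set of `P₂`, where `M₁ = M₂ ∩ σ_{P₁}`. -/
def consExt {α : Type} (P1 P2 : List (AugClause α)) : Prop :=
  (∀ M2 : Set α, isAnswerSet P2 M2 → isAnswerSet P1 (M2 ∩ progSig P1)) ∧
  (∀ M1 : Set α, isAnswerSet P1 M1 →
    ∃ M2 : Set α, isAnswerSet P2 M2 ∧ M1 = M2 ∩ progSig P1)

/-- `P₂` is a strong conservative extension of the user program `P₁` (relative
to the user signature `U`): for every user program `P`, `P₂ ∪ P` is a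
conservative extension of `P₁ ∪ P`. -/
def strongConsExt {α : Type} (P1 P2 : List (AugClause α)) (U : Set α) : Prop :=
  ∀ P : List (AugClause α), progSig P ⊆ U → consExt (P1 ++ P) (P2 ++ P)

mutual
  /-- Negation normal form: push negations inward (no pending negation). -/
  def nnf0 {α : Type} : NF α → NF α
    | .var a => .var a
    | .top => .top
    | .bot => .bot
    | .conj A B => .conj (nnf0 A) (nnf0 B)
    | .disj A B => .disj (nnf0 A) (nnf0 B)
    | .neg A => nnf1 A
  /-- Negation normal form under one pending negation. -/
  def nnf1 {α : Type} : NF α → NF α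
    | .var a => .neg (.var a)
    | .top => .bot
    | .bot => .top
    | .conj A B => .disj (nnf1 A) (nnf1 B)
    | .disj A B => .conj (nnf1 A) (nnf1 B)
    | .neg A => nnf2 A
  /-- Negation normal form under two pending negations. -/
  def nnf2 {α : Type} : NF α → NF α
    | .var a => .neg (.neg (.var a))
    | .top => .top
    | .bot => .bot
    | .conj A B => .conj (nnf2 A) (nnf2 B)
    | .disj A B => .disj (nnf2 A) (nnf2 B)
    | .neg A => nnf1 A
end

/-- Conjunctive normal form (list of disjunction-lists of leaves). -/
def cnfNF {α : Type} : NF α → List (List (NF α))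
  | .conj A B => cnfNF A ++ cnfNF B
  | .disj A B => (cnfNF A).flatMap fun c => (cnfNF B).map fun d => c ++ d
  | F => [[F]]

/-- Disjunctive normal form (list of conjunction-lists of leaves). -/
def dnfNF {α : Type} : NF α → List (List (NF α))
  | .disj A B => dnfNF A ++ dnfNF B
  | .conj A B => (dnfNF A).flatMap fun c => (dnfNF B).map fun d => c ++ d
  | F => [[F]]

/-- Read a leaf as a literal (if it is one). -/
def leafLit {α : Type} : NF α → Option (α × Bool)
  | .var a => some (a, true)
  | .neg (.var a) => some (a, false)
  | _ => none

/-- Read a leaf `¬¬a` as the literal `¬a` to be moved to the other side. -/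
def dnegLit {α : Type} : NF α → Option (α × Bool)
  | .neg (.neg (.var a)) => some (a, false)
  | _ => none

/-- Build a free clause from a head disjunct-list and a body conjunct-list:
doubly negated atoms `¬¬a` in the head become `¬a` in the body and vice versa;
trivial clauses (⊤ in the head or ⊥ in the body) are removed. -/
def procClause {α : Type} [DecidableEq α] (hd bd : List (NF α)) :
    Option (FClause α) :=
  if NF.top ∈ hd ∨ NF.bot ∈ bd then none
  else some ⟨hd.filterMap leafLit ++ bd.filterMap dnegLit,
             bd.filterMap leafLit ++ hd.filterMap dnegLit⟩

/-- `AugFree(P)`: the free program obtained from the augmented program `P` by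
pushing negations inward, taking CNF of heads and DNF of bodies, splitting
conjunctions in heads and disjunctions in bodies into separate clauses, and
eliminating doubly negated atoms. -/
def augFree {α : Type} [DecidableEq α] (P : List (AugClause α)) :
    List (FClause α) :=
  P.flatMap fun c =>
    (cnfNF (nnf0 c.1)).flatMap fun hd =>
      (dnfNF (nnf0 c.2)).filterMap fun bd => procClause hd bd

/-- Positive formulas: no negation (in particular no ⊥) occurs. -/
def IsPositive {α : Type} : PropForm α → Prop
  | .var _ => True
  | .fals => False
  | .conj A B => IsPositive A ∧ IsPositive B
  | .disj A B => IsPositive A ∧ IsPositive B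
  | .impl A B => IsPositive A ∧ IsPositive B

/-- The set 𝐍 of two-negated formulas. -/
inductive IsTwoNeg {α : Type} : PropForm α → Prop
  | atom (a : α) : IsTwoNeg (neg (neg (var a)))
  | dneg {A} : IsTwoNeg A → IsTwoNeg (neg (neg A))
  | conj {A B} : IsTwoNeg A → IsTwoNeg B → IsTwoNeg (PropForm.conj A B)
  | disjL {A} (B) : IsTwoNeg A → IsTwoNeg (PropForm.disj A B)
  | disjR {A} (B) : IsTwoNeg A → IsTwoNeg (PropForm.disj B A)
  | himp {A} (B) : IsTwoNeg A → IsTwoNeg (PropForm.impl B A)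

namespace Deriv

variable {α : Type} {T U : Set (PropForm α)} {A B F : PropForm α}

/-- Axioms may be replaced by derivations of them. -/
theorem trans (h : Deriv T F) (hU : ∀ G ∈ T, Deriv U G) : Deriv U F := by
  induction h with
  | ax h => exact hU _ h
  | mp _ _ ih₁ ih₂ => exact ih₁.mp ih₂
  | k A B => exact k A B
  | s A B C => exact s A B C
  | conjIntro A B => exact conjIntro A B
  | conjElimL A B => exact conjElimL A B
  | conjElimR A B => exact conjElimR A B
  | disjIntroL A B => exact disjIntroL A B
  | disjIntroR A B => exact disjIntroR A B
  | disjElim A B C => exact disjElim A B C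
  | falsElim A => exact falsElim A

theorem mono (h : Deriv T F) (hTU : T ⊆ U) : Deriv U F :=
  h.trans fun _ hG => ax (hTU hG)

theorem const (h : Deriv T B) : Deriv T (impl A B) := (k B A).mp h

theorem refl (A : PropForm α) : Deriv T (impl A A) :=
  ((s A (impl A A) A).mp (k A (impl A A))).mp (k A A)

/-- The deduction theorem. -/
theorem deduction (h : Deriv (insert A T) B) : Deriv T (impl A B) := by
  induction h with
  | ax h =>
    rcases h with rfl | h
    · exact refl _
    · exact (ax h).const
  | mp _ _ ih₁ ih₂ => exact ((s _ _ _).mp ih₁).mp ih₂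
  | k A B => exact (k A B).const
  | s A B C => exact (s A B C).const
  | conjIntro A B => exact (conjIntro A B).const
  | conjElimL A B => exact (conjElimL A B).const
  | conjElimR A B => exact (conjElimR A B).const
  | disjIntroL A B => exact (disjIntroL A B).const
  | disjIntroR A B => exact (disjIntroR A B).const
  | disjElim A B C => exact (disjElim A B C).const
  | falsElim A => exact (falsElim A).const

/-- A derivation uses only finitely many axioms. -/
theorem exists_list (h : Deriv T F) :
    ∃ L : List (PropForm α), (∀ G ∈ L, G ∈ T) ∧ Deriv {G | G ∈ L} F := by
  induction h with
  | @ax A h => exact ⟨[A], by simpa using h, ax (by simp)⟩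
  | mp _ _ ih₁ ih₂ =>
    obtain ⟨L₁, hL₁, h₁⟩ := ih₁
    obtain ⟨L₂, hL₂, h₂⟩ := ih₂
    refine ⟨L₁ ++ L₂, fun G hG => (List.mem_append.1 hG).elim (hL₁ G) (hL₂ G), ?_⟩
    exact (h₁.mono fun G hG => List.mem_append_left _ hG).mp
      (h₂.mono fun G hG => List.mem_append_right _ hG)
  | k A B => exact ⟨[], by simp, k A B⟩
  | s A B C => exact ⟨[], by simp, s A B C⟩
  | conjIntro A B => exact ⟨[], by simp, conjIntro A B⟩
  | conjElimL A B => exact ⟨[], by simp, conjElimL A B⟩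
  | conjElimR A B => exact ⟨[], by simp, conjElimR A B⟩
  | disjIntroL A B => exact ⟨[], by simp, disjIntroL A B⟩
  | disjIntroR A B => exact ⟨[], by simp, disjIntroR A B⟩
  | disjElim A B C => exact ⟨[], by simp, disjElim A B C⟩
  | falsElim A => exact ⟨[], by simp, falsElim A⟩

theorem bigConj_iff {L : List (PropForm α)} :
    Deriv T (bigConj L) ↔ ∀ G ∈ L, Deriv T G := by
  induction L with
  | nil => exact iff_of_true (refl fals) (by simp)
  | cons A L ih =>
    cases L with
    | nil => simp [bigConj]
    | cons B L =>
      rw [List.forall_mem_cons, ← ih]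
      change Deriv T (conj A (bigConj (B :: L))) ↔ _
      exact ⟨fun h => ⟨(conjElimL _ _).mp h, (conjElimR _ _).mp h⟩,
        fun h => ((conjIntro _ _).mp h.1).mp h.2⟩

end Deriv

section Semantics

variable {α : Type} {T Γ : Set (PropForm α)} {F : PropForm α} {P : List (AugClause α)}
  {N M X Y : Set α}

theorem iProves_iff_deriv : IProves T F ↔ Deriv T F := by
  constructor
  · rintro ⟨L, hL, h⟩
    exact (h.mono (Set.empty_subset T)).mp (Deriv.bigConj_iff.2 fun G hG => .ax (hL G hG))
  · intro h
    obtain ⟨L, hL, h⟩ := h.exists_list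
    refine ⟨L, hL, Deriv.deduction (h.trans fun G hG => ?_)⟩
    exact Deriv.bigConj_iff.1 (.ax (Set.mem_insert _ _)) G hG

/-- `Γ` does not derive `F`, and is maximal with this property. -/
def MaximallyAvoids (Γ : Set (PropForm α)) (F : PropForm α) : Prop :=
  ¬ Deriv Γ F ∧ ∀ A ∉ Γ, Deriv (insert A Γ) F

/-- Lindenbaum's lemma. -/
theorem exists_maximallyAvoids (h : ¬ Deriv T F) : ∃ Γ, T ⊆ Γ ∧ MaximallyAvoids Γ F := by
  obtain ⟨Γ, hTΓ, hΓ⟩ := zorn_subset_nonempty {U | ¬ Deriv U F} (fun c hc hchain hne => by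
    refine ⟨⋃₀ c, fun hd => ?_, fun _ => Set.subset_sUnion_of_mem⟩
    obtain ⟨L, hL, hd⟩ := hd.exists_list
    obtain ⟨U, hU, hLU⟩ := hchain.directedOn.exists_mem_subset_of_finite_of_subset_sUnion
      hne L.finite_toSet hL
    exact hc hU (hd.mono hLU)) T h
  refine ⟨Γ, hTΓ, hΓ.prop, fun A hA => ?_⟩
  by_contra hd
  exact hA (hΓ.le_of_ge hd (Set.subset_insert A Γ) (Set.mem_insert A Γ))

namespace MaximallyAvoids

variable {A B : PropForm α}

theorem mem_iff (h : MaximallyAvoids Γ F) : A ∈ Γ ↔ Deriv Γ A :=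
  ⟨.ax, fun hA => by_contra fun hn => h.1 ((h.2 A hn).deduction.mp hA)⟩

theorem mem_mp (h : MaximallyAvoids Γ F) (hAB : impl A B ∈ Γ) (hA : A ∈ Γ) : B ∈ Γ :=
  h.mem_iff.2 ((Deriv.ax hAB).mp (.ax hA))

theorem fals_notMem (h : MaximallyAvoids Γ F) : fals ∉ Γ :=
  fun hf => h.1 ((Deriv.falsElim F).mp (.ax hf))

theorem conj_mem_iff (h : MaximallyAvoids Γ F) : conj A B ∈ Γ ↔ A ∈ Γ ∧ B ∈ Γ := by
  simp only [h.mem_iff]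
  exact ⟨fun hd => ⟨(Deriv.conjElimL _ _).mp hd, (Deriv.conjElimR _ _).mp hd⟩,
    fun hd => ((Deriv.conjIntro _ _).mp hd.1).mp hd.2⟩

theorem disj_mem_iff (h : MaximallyAvoids Γ F) : disj A B ∈ Γ ↔ A ∈ Γ ∨ B ∈ Γ := by
  constructor
  · intro hd
    by_contra! hn
    exact h.1 ((((Deriv.disjElim A B F).mp (h.2 A hn.1).deduction).mp
      (h.2 B hn.2).deduction).mp (.ax hd))
  · simp only [h.mem_iff]
    exact fun hd => hd.elim (Deriv.disjIntroL _ _).mp (Deriv.disjIntroR _ _).mp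

/-- A maximal consistent set is the set of formulas true in a classical interpretation. -/
theorem mem_iff_sat2 (h : MaximallyAvoids Γ fals) :
    A ∈ Γ ↔ sat2 {a | PropForm.var a ∈ Γ} A := by
  induction A with
  | var a => rfl
  | fals => exact iff_of_false h.fals_notMem id
  | conj A B ihA ihB => simp only [h.conj_mem_iff, sat2, ihA, ihB]
  | disj A B ihA ihB => simp only [h.disj_mem_iff, sat2, ihA, ihB]
  | impl A B ihA ihB =>
    rw [sat2, ← ihA, ← ihB]
    refine ⟨h.mem_mp, fun hAB => h.mem_iff.2 ?_⟩
    by_cases hA : A ∈ Γ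
    · exact (Deriv.ax (hAB hA)).const
    · exact Deriv.deduction ((Deriv.falsElim B).mp (h.2 A hA))

end MaximallyAvoids

/-- A theory that is consistent intuitionistically has a classical model. -/
theorem exists_isModel2 (h : ¬ Deriv T fals) : ∃ X, isModel2 X T := by
  obtain ⟨Γ, hTΓ, hΓ⟩ := exists_maximallyAvoids h
  exact ⟨_, fun A hA => hΓ.mem_iff_sat2.1 (hTΓ hA)⟩

/-- Satisfaction in the here-and-there model `(N, M)`. -/
def satHT (N M : Set α) : PropForm α → Prop
  | .var a => a ∈ N
  | .fals => False
  | .conj A B => satHT N M A ∧ satHT N M B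
  | .disj A B => satHT N M A ∨ satHT N M B
  | .impl A B => (satHT N M A → satHT N M B) ∧ (sat2 M A → sat2 M B)

theorem sat2_of_satHT (hNM : N ⊆ M) : satHT N M F → sat2 M F := by
  induction F with
  | var a => exact fun h => hNM h
  | fals => exact id
  | conj A B ihA ihB => exact And.imp ihA ihB
  | disj A B ihA ihB => exact Or.imp ihA ihB
  | impl A B _ _ => exact And.right

theorem satHT_self : satHT M M F ↔ sat2 M F := by
  induction F with
  | var a => rfl
  | fals => rfl
  | conj A B ihA ihB => simp only [satHT, sat2, ihA, ihB]
  | disj A B ihA ihB => simp only [satHT, sat2, ihA, ihB]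
  | impl A B ihA ihB => simp only [satHT, sat2, ihA, ihB, and_self]

/-- Intuitionistic derivability is sound for here-and-there models. -/
theorem Deriv.satHT (h : Deriv T F) (hNM : N ⊆ M) (hT : ∀ G ∈ T, satHT N M G) :
    satHT N M F := by
  have pers : ∀ G, ASP.satHT N M G → sat2 M G := fun _ => sat2_of_satHT hNM
  induction h with
  | ax h => exact hT _ h
  | mp _ _ ih₁ ih₂ => exact ih₁.1 ih₂
  | s A B C =>
    simp only [ASP.satHT, sat2]
    have := pers A
    have := pers B
    have := pers C
    tauto
  | k A B | conjIntro A B =>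
    simp only [ASP.satHT, sat2]
    have := pers A
    have := pers B
    tauto
  | conjElimL A B | conjElimR A B | disjIntroL A B | disjIntroR A B | falsElim A =>
    simp only [ASP.satHT, sat2]
    tauto
  | disjElim A B C =>
    simp only [ASP.satHT, sat2]
    have := pers A
    have := pers B
    have := pers C
    tauto

theorem Deriv.sat2 (h : Deriv T F) (hT : isModel2 M T) : sat2 M F :=
  satHT_self.1 (h.satHT subset_rfl fun G hG => satHT_self.2 (hT G hG))

theorem NF.satB_reduct_self (G : NF α) : satB M (reduct M G) ↔ sat2 M G.toProp := by
  induction G with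
  | var a => rfl
  | top => simp [reduct, satB, toProp, PropForm.top, sat2]
  | bot => rfl
  | conj A B ihA ihB => simp only [reduct, satB, toProp, sat2, ihA, ihB]
  | disj A B ihA ihB => simp only [reduct, satB, toProp, sat2, ihA, ihB]
  | neg A ih =>
    by_cases h : sat2 M A.toProp <;>
      simp [reduct, satB, toProp, PropForm.neg, sat2, ih, h]

theorem NF.satB_reduct_neg (G : NF α) :
    satB N (reduct M G.neg) ↔ ¬ sat2 M G.toProp := by
  by_cases h : sat2 M G.toProp <;> simp [reduct, satB, satB_reduct_self, h]

theorem NF.satHT_toProp (hNM : N ⊆ M) (G : NF α) :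
    satHT N M G.toProp ↔ satB N (reduct M G) := by
  induction G with
  | var a => rfl
  | top => simp [reduct, satB, toProp, PropForm.top, satHT, sat2]
  | bot => rfl
  | conj A B ihA ihB => simp only [reduct, satB, toProp, satHT, ihA, ihB]
  | disj A B ihA ihB => simp only [reduct, satB, toProp, satHT, ihA, ihB]
  | neg A =>
    rw [satB_reduct_neg]
    exact ⟨And.right, fun h => ⟨fun hA => h (sat2_of_satHT hNM hA), h⟩⟩

theorem NF.sat2_toProp_congr (G : NF α) (h : ∀ a ∈ G.atoms, a ∈ X ↔ a ∈ Y) :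
    sat2 X G.toProp ↔ sat2 Y G.toProp := by
  induction G with
  | var a => exact h a rfl
  | top => rfl
  | bot => rfl
  | conj A B ihA ihB =>
    exact and_congr (ihA fun a ha => h a (.inl ha)) (ihB fun a ha => h a (.inr ha))
  | disj A B ihA ihB =>
    exact or_congr (ihA fun a ha => h a (.inl ha)) (ihB fun a ha => h a (.inr ha))
  | neg A ih => exact not_congr (ih h)

theorem NF.satB_reduct_congr (G : NF α) (h : ∀ a ∈ G.atoms, a ∈ X ↔ a ∈ Y) :
    satB X (reduct M G) ↔ satB Y (reduct M G) := by
  induction G with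
  | var a => exact h a rfl
  | top => rfl
  | bot => rfl
  | conj A B ihA ihB =>
    exact and_congr (ihA fun a ha => h a (.inl ha)) (ihB fun a ha => h a (.inr ha))
  | disj A B ihA ihB =>
    exact or_congr (ihA fun a ha => h a (.inl ha)) (ihB fun a ha => h a (.inr ha))
  | neg A => rw [satB_reduct_neg, satB_reduct_neg]

theorem closedUnder_progReduct_iff :
    closedUnder N (progReduct M P) ↔
      ∀ c ∈ P, NF.satB N (c.2.reduct M) → NF.satB N (c.1.reduct M) := by
  simp only [closedUnder, progReduct, List.forall_mem_map]

theorem isModel2_progTh_iff :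
    isModel2 X (progTh P) ↔ ∀ c ∈ P, sat2 X c.2.toProp → sat2 X c.1.toProp :=
  ⟨fun h c hc => h _ ⟨c, hc, rfl⟩, fun h _ ⟨c, hc, hF⟩ => hF ▸ h c hc⟩

theorem closedUnder_progReduct_self :
    closedUnder M (progReduct M P) ↔ isModel2 M (progTh P) := by
  simp only [closedUnder_progReduct_iff, NF.satB_reduct_self, isModel2_progTh_iff]

theorem isModel2_progTh_congr (h : ∀ a ∈ progSig P, a ∈ X ↔ a ∈ Y) :
    isModel2 X (progTh P) ↔ isModel2 Y (progTh P) := by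
  simp only [isModel2_progTh_iff]
  refine forall₂_congr fun c hc => imp_congr ?_ ?_
  · exact c.2.sat2_toProp_congr fun a ha => h a ⟨c, hc, .inr ha⟩
  · exact c.1.sat2_toProp_congr fun a ha => h a ⟨c, hc, .inl ha⟩

theorem closedUnder_progReduct_congr (h : ∀ a ∈ progSig P, a ∈ X ↔ a ∈ Y) :
    closedUnder X (progReduct M P) ↔ closedUnder Y (progReduct M P) := by
  simp only [closedUnder_progReduct_iff]
  refine forall₂_congr fun c hc => imp_congr ?_ ?_
  · exact c.2.satB_reduct_congr fun a ha => h a ⟨c, hc, .inr ha⟩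
  · exact c.1.satB_reduct_congr fun a ha => h a ⟨c, hc, .inl ha⟩

theorem isModel2_union_negSet :
    isModel2 X (progTh P ∪ negSet (progSig P \ M)) ↔
      isModel2 X (progTh P) ∧ ∀ a ∈ progSig P, a ∈ X → a ∈ M := by
  have h : isModel2 X (negSet (progSig P \ M)) ↔ ∀ a ∈ progSig P, a ∈ X → a ∈ M := by
    simp only [isModel2, negSet, Set.forall_mem_image, PropForm.neg, sat2, Set.mem_sdiff]
    exact forall_congr' fun a => by tauto
  rw [← h]
  simp only [isModel2, Set.mem_union, or_imp, forall_and]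

/-- If `M` is a minimal model of `P`, then every classical model of `P` and the negations of the
atoms outside `M` agrees with `M` on the signature of `P`. -/
theorem isMinModel.agree (hmin : isMinModel (progTh P) M)
    (hX : isModel2 X (progTh P ∪ negSet (progSig P \ M))) :
    ∀ a ∈ progSig P, a ∈ X ↔ a ∈ M := by
  obtain ⟨hXP, hXM⟩ := isModel2_union_negSet.1 hX
  have hagree : ∀ a ∈ progSig P, a ∈ X ↔ a ∈ X ∩ M :=
    fun a ha => ⟨fun h => ⟨h, hXM a ha h⟩, And.left⟩
  have heq := hmin.2 (X ∩ M) Set.inter_subset_right ((isModel2_progTh_congr hagree).1 hXP)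
  rwa [heq] at hagree

/-- For a prime theory extending `P` and the negations of the atoms outside a minimal model `M`,
membership of a nested formula is satisfaction of its reduct by the atoms of the theory. -/
theorem MaximallyAvoids.toProp_mem_iff (hΓ : MaximallyAvoids Γ F)
    (hmin : isMinModel (progTh P) M) (hT : progTh P ∪ negSet (progSig P \ M) ⊆ Γ)
    (G : NF α) (hG : G.atoms ⊆ progSig P) :
    G.toProp ∈ Γ ↔ NF.satB {a | PropForm.var a ∈ Γ} (G.reduct M) := by
  induction G with
  | var a => rfl
  | top => exact iff_of_true (hΓ.mem_iff.2 (.refl fals)) trivial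
  | bot => exact iff_of_false hΓ.fals_notMem id
  | conj A B ihA ihB =>
    rw [NF.toProp, hΓ.conj_mem_iff, ihA fun a ha => hG (.inl ha), ihB fun a ha => hG (.inr ha)]
    rfl
  | disj A B ihA ihB =>
    rw [NF.toProp, hΓ.disj_mem_iff, ihA fun a ha => hG (.inl ha), ihB fun a ha => hG (.inr ha)]
    rfl
  | neg A =>
    have hsat : ∀ X, isModel2 X Γ → (sat2 X A.toProp ↔ sat2 M A.toProp) := fun X hX =>
      A.sat2_toProp_congr fun a ha => hmin.agree (fun G hG => hX G (hT hG)) a (hG ha)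
    rw [NF.satB_reduct_neg]
    constructor
    · intro hA
      obtain ⟨X, hX⟩ := exists_isModel2 fun h => hΓ.fals_notMem (hΓ.mem_iff.2 h)
      exact (hsat X hX).not.1 (hX _ hA)
    · intro hM
      refine hΓ.mem_iff.2 (Deriv.deduction ?_)
      by_contra hcons
      obtain ⟨X, hX⟩ := exists_isModel2 hcons
      exact hM ((hsat X fun G hG => hX G (.inr hG)).1 (hX _ (.inl rfl)))

/-- A min-answer set consists of intuitionistic consequences of `P` together with the negations
of the atoms outside it. -/
theorem deriv_var_of_isMinAnswerSet (h : isMinAnswerSet P M) {a : α} (ha : a ∈ M) :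
    Deriv (progTh P ∪ negSet (progSig P \ M)) (PropForm.var a) := by
  by_contra hd
  obtain ⟨Γ, hT, hΓ⟩ := exists_maximallyAvoids hd
  set V : Set α := {b | PropForm.var b ∈ Γ}
  have hVM : ∀ b ∈ progSig P, b ∈ V ↔ b ∈ V ∩ M := by
    refine fun b hb => ⟨fun hbV => ⟨hbV, ?_⟩, And.left⟩
    by_contra hbM
    exact hΓ.fals_notMem (hΓ.mem_mp (hT (.inr ⟨b, ⟨hb, hbM⟩, rfl⟩)) hbV)
  have hV : closedUnder V (progReduct M P) := by
    refine closedUnder_progReduct_iff.2 fun c hc hbody => ?_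
    rw [← hΓ.toProp_mem_iff h.2 hT _ fun b hb => ⟨c, hc, .inr hb⟩] at hbody
    rw [← hΓ.toProp_mem_iff h.2 hT _ fun b hb => ⟨c, hc, .inl hb⟩]
    exact hΓ.mem_mp (hT (.inl ⟨c, hc, rfl⟩)) hbody
  have heq := h.1.2 (V ∩ M) Set.inter_subset_right ((closedUnder_progReduct_congr hVM).1 hV)
  rw [← heq] at ha
  exact hΓ.1 (.ax ha.1)

end Semantics

/-- `M` is a min-answer set of `P` (an answer set which is also a
minimal model) iff `P ∪ ¬M̃ ⊩_I M`. -/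
theorem minAnswerSet_iff_intuitionistic {α : Type} (P : List (AugClause α))
    (M : Set α) (hM : M ⊆ progSig P) :
    (isAnswerSet P M ∧ isMinModel (progTh P) M) ↔
      IProvesAll (progTh P ∪ negSet (progSig P \ M)) M := by
  simp only [IProvesAll, IConsistent, iProves_iff_deriv]
  constructor
  · intro h
    refine ⟨fun hd => ?_, fun a => deriv_var_of_isMinAnswerSet h⟩
    exact hd.sat2 (isModel2_union_negSet.2 ⟨h.2.1, fun _ _ => id⟩)
  · rintro ⟨hcons, hprov⟩
    obtain ⟨X, hX⟩ := exists_isModel2 hcons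
    have hXM := isModel2_union_negSet.1 hX
    have hmodel : isModel2 M (progTh P) := (isModel2_progTh_congr fun a ha =>
      ⟨hXM.2 a ha, fun haM => (hprov a haM).sat2 hX⟩).1 hXM.1
    refine ⟨⟨closedUnder_progReduct_self.2 hmodel, fun N hN hclosed => ?_⟩,
      hmodel, fun N hN hNP => ?_⟩
    · refine hN.antisymm fun a ha => (hprov a ha).satHT hN ?_
      rintro _ (⟨c, hc, rfl⟩ | ⟨b, hb, rfl⟩)
      · refine ⟨?_, hmodel _ ⟨c, hc, rfl⟩⟩
        rw [NF.satHT_toProp hN, NF.satHT_toProp hN]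
        exact closedUnder_progReduct_iff.1 hclosed c hc
      · exact ⟨fun hbN => hb.2 (hN hbN), hb.2⟩
    · exact hN.antisymm fun a ha =>
        (hprov a ha).sat2 (isModel2_union_negSet.2 ⟨hNP, fun _ _ hb => hN hb⟩)

end ASP
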